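/- Let γ : [0,L] → ℝ² be a smooth unit-speed curve whose curvature κ(t) satisfies 0 < K_min ≤ κ(t) ≤ K_max and whose total curvature ∫₀^L κ(t) dt is less than π/2, and let θ : ℝ → [0,1] be a smooth even function with θ(x) = 1 for |x| < 1 and θ(x) = 0 for |x| > 2. There is a constant C₀ > 0 depending only on the curve and on θ such that for every λ ≥ 1, every 0 < σ < 1, and every family a_μ ∈ ℂ (μ ∈ E_λ) with Σ_{μ∈E_λ} |a_μ|² = 1, the function f₀(t) = Σ_{μ∈E_λ} a_μ θ(φ_μ'(t)/σ) e^{iλ φ_μ(t)} satisfies ∫₀^L |f₀(t)|² dt ≤ C₀·(σ + #E_λ/λ^{1/6}). -/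

import Mathlib

open MeasureTheory Real

noncomputable section

/-- The Euclidean norm of a vector in `ℝ × ℝ`. -/
def e2 (x : ℝ × ℝ) : ℝ := Real.sqrt (x.1 ^ 2 + x.2 ^ 2)

/-- The integer vector `μ` viewed as a vector in `ℝ × ℝ`. -/
def iv (μ : ℤ × ℤ) : ℝ × ℝ := ((μ.1 : ℝ), (μ.2 : ℝ))

/-- The set of lattice points on the circle of radius `lam`. -/
def Elat (lam : ℝ) : Finset (ℤ × ℤ) := by
  classical
  exact (Finset.Icc (-⌈lam⌉, -⌈lam⌉) (⌈lam⌉, ⌈lam⌉)).filter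
    (fun μ => (μ.1 : ℝ) ^ 2 + (μ.2 : ℝ) ^ 2 = lam ^ 2)

/-- `B_lam`: the maximal number of lattice points on the circle of radius `lam`
lying in an arc of length `√lam`. -/
def Bmax (lam : ℝ) : ℕ := by
  classical
  exact sSup {n : ℕ | ∃ x : ℝ × ℝ, e2 x = lam ∧
    n = ((Elat lam).filter fun ξ => e2 (iv ξ - x) ≤ Real.sqrt lam).card}

/-- If `g` and `g'` do not vanish simultaneously, in the quantitative sense
`1 ≤ g ^ 2 + K * g' ^ 2`, then `g` spends little time near `0`. -/
theorem integral_inv_sq_add_sq_le {L M K δ : ℝ} {g g' g'' : ℝ → ℝ} (hL : 0 ≤ L)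
    (hg : ∀ t, HasDerivAt g (g' t) t) (hg' : ∀ t, HasDerivAt g' (g'' t) t)
    (hc : Continuous g'') (hM : ∀ t ∈ Set.Icc 0 L, |g' t| ≤ M)
    (hM' : ∀ t ∈ Set.Icc 0 L, |g'' t| ≤ M) (hK : 0 ≤ K)
    (hnd : ∀ t ∈ Set.Ioo 0 L, 1 ≤ g t ^ 2 + K * g' t ^ 2) (hδ : 0 < δ) (hδ1 : δ ≤ 1) :
    ∫ t in (0 : ℝ)..L, 1 / (g t ^ 2 + δ ^ 2) ≤ (L + K * (M * π + M * (π / 2) * L)) / δ := by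
  have cg : Continuous g := continuous_iff_continuousAt.2 fun t => (hg t).continuousAt
  have cg' : Continuous g' := continuous_iff_continuousAt.2 fun t => (hg' t).continuousAt
  have hpos : ∀ t, 0 < g t ^ 2 + δ ^ 2 := fun t => by positivity
  have hG : ∀ t, HasDerivAt (fun t => g' t * arctan (g t / δ))
      (g'' t * arctan (g t / δ) + δ * g' t ^ 2 / (g t ^ 2 + δ ^ 2)) t := by
    intro t
    refine ((hg' t).mul ((hg t).div_const δ).arctan).congr_deriv ?_
    have := (hpos t).ne'
    have h2 : δ ^ 2 + g t ^ 2 ≠ 0 := by positivity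
    field_simp
    ring
  have cG : Continuous fun t =>
      g'' t * arctan (g t / δ) + δ * g' t ^ 2 / (g t ^ 2 + δ ^ 2) := by
    have h1 : Continuous fun t => arctan (g t / δ) := continuous_arctan.comp (cg.div_const δ)
    exact (hc.mul h1).add (Continuous.div (by fun_prop) (by fun_prop) fun t => (hpos t).ne')
  have hatan : ∀ x, |arctan x| ≤ π / 2 := fun x =>
    abs_le.2 ⟨(neg_pi_div_two_lt_arctan x).le, (arctan_lt_pi_div_two x).le⟩
  have hM0 : 0 ≤ M := (abs_nonneg _).trans (hM 0 ⟨le_rfl, hL⟩)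
  have hbd : ∀ t ∈ Set.Icc 0 L, |g' t * arctan (g t / δ)| ≤ M * (π / 2) := fun t ht => by
    rw [abs_mul]
    exact mul_le_mul (hM t ht) (hatan _) (abs_nonneg _) hM0
  have hle : ∫ t in (0 : ℝ)..L, 1 / (g t ^ 2 + δ ^ 2) ≤ ∫ t in (0 : ℝ)..L, (1 + K / δ *
      ((g'' t * arctan (g t / δ) + δ * g' t ^ 2 / (g t ^ 2 + δ ^ 2)) + M * (π / 2))) := by
    refine intervalIntegral.integral_mono_on_of_le_Ioo hL ?_ ?_ fun t ht => ?_
    · exact (Continuous.div (by fun_prop) (by fun_prop)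
        fun t => (hpos t).ne').intervalIntegrable _ _
    · exact (continuous_const.add (continuous_const.mul
        (cG.add continuous_const))).intervalIntegrable _ _
    · have ht' : t ∈ Set.Icc 0 L := ⟨ht.1.le, ht.2.le⟩
      have h1 : -(M * (π / 2)) ≤ g'' t * arctan (g t / δ) := by
        refine (abs_le.1 ?_).1
        rw [abs_mul]
        exact mul_le_mul (hM' t ht') (hatan _) (abs_nonneg _) hM0
      calc 1 / (g t ^ 2 + δ ^ 2) ≤ ((g t ^ 2 + δ ^ 2) + K * g' t ^ 2) / (g t ^ 2 + δ ^ 2) := by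
            have := hnd t ht
            have h3 := hpos t
            gcongr
            nlinarith [sq_nonneg δ]
        _ = 1 + K / δ * (δ * g' t ^ 2 / (g t ^ 2 + δ ^ 2)) := by
            have := (hpos t).ne'
            field_simp
        _ ≤ _ := by
            gcongr
            linarith
  have hint : ∫ t in (0 : ℝ)..L, (1 + K / δ *
      ((g'' t * arctan (g t / δ) + δ * g' t ^ 2 / (g t ^ 2 + δ ^ 2)) + M * (π / 2))) =
      L + K / δ * ((g' L * arctan (g L / δ) - g' 0 * arctan (g 0 / δ)) + M * (π / 2) * L) := by
    have cG1 : Continuous fun t => K / δ *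
        ((g'' t * arctan (g t / δ) + δ * g' t ^ 2 / (g t ^ 2 + δ ^ 2)) + M * (π / 2)) :=
      continuous_const.mul (cG.add continuous_const)
    rw [intervalIntegral.integral_add (by simp) (cG1.intervalIntegrable _ _),
      intervalIntegral.integral_const_mul,
      intervalIntegral.integral_add (cG.intervalIntegrable _ _) (by simp),
      intervalIntegral.integral_eq_sub_of_hasDerivAt (fun t _ => hG t)
        (cG.intervalIntegrable _ _)]
    simp
    ring_nf
    simp
  rw [hint] at hle
  refine hle.trans ?_
  have h1 := (abs_le.1 (hbd L ⟨hL, le_rfl⟩)).2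
  have h2 := (abs_le.1 (hbd 0 ⟨le_rfl, hL⟩)).1
  have h3 : L ≤ L / δ := by
    rw [le_div_iff₀ hδ]; nlinarith
  calc _ ≤ L / δ + K / δ * (M * π + M * (π / 2) * L) := by
        gcongr
        linarith
    _ = _ := by ring

/-- A van der Corput type bound for an oscillatory integral with phase `Φ` satisfying
`Φ' = g / δ ^ 2` and amplitude `A`. -/
theorem norm_integral_mul_exp_le {L M C D δ : ℝ} {A A' g g' Φ : ℝ → ℝ} (hL : 0 ≤ L)
    (hδ : 0 < δ)
    (hA : ∀ t, HasDerivAt A (A' t) t) (cA' : Continuous A')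
    (hg : ∀ t, HasDerivAt g (g' t) t) (cg' : Continuous g')
    (hΦ : ∀ t, HasDerivAt Φ (g t / δ ^ 2) t)
    (hA1 : ∀ t, |A t| ≤ 1) (hM : ∀ t ∈ Set.Icc 0 L, |g' t| ≤ M)
    (hC : ∫ t in (0 : ℝ)..L, 1 / (g t ^ 2 + δ ^ 2) ≤ C / δ)
    (hD : ∫ t in (0 : ℝ)..L, |A' t| ≤ D) :
    ‖∫ t in (0 : ℝ)..L, (A t : ℂ) * Complex.exp (Complex.I * (Φ t : ℂ))‖ ≤
      (2 + D + (M + 1) * C) * δ := by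
  have cA : Continuous A := continuous_iff_continuousAt.2 fun t => (hA t).continuousAt
  have cg : Continuous g := continuous_iff_continuousAt.2 fun t => (hg t).continuousAt
  have cΦ : Continuous Φ := continuous_iff_continuousAt.2 fun t => (hΦ t).continuousAt
  have hpos : ∀ t, 0 < g t ^ 2 + δ ^ 2 := fun t => by positivity
  have hM0 : 0 ≤ M := (abs_nonneg _).trans (hM 0 ⟨le_rfl, hL⟩)
  set q : ℝ → ℝ := fun t => g t / (g t ^ 2 + δ ^ 2) with hq
  set q' : ℝ → ℝ := fun t => g' t * (δ ^ 2 - g t ^ 2) / (g t ^ 2 + δ ^ 2) ^ 2 with hq'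
  set E : ℝ → ℂ := fun t => Complex.exp (Complex.I * (Φ t : ℂ)) with hE
  have nE : ∀ t, ‖E t‖ = 1 := fun t => by
    simp only [hE]; rw [mul_comm]; exact Complex.norm_exp_ofReal_mul_I _
  have cE : Continuous E := by fun_prop
  have dq : ∀ t, HasDerivAt q (q' t) t := fun t => by
    refine ((hg t).div (((hg t).pow 2).add_const (δ ^ 2)) (hpos t).ne').congr_deriv ?_
    simp only [hq', Pi.pow_apply]
    congr 1
    push_cast
    ring
  have cq : Continuous q := continuous_iff_continuousAt.2 fun t => (dq t).continuousAt
  have cq' : Continuous q' :=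
    Continuous.div (by fun_prop) (by fun_prop) fun t => (pow_pos (hpos t) 2).ne'
  have bq : ∀ t, |q t| ≤ 1 / δ := fun t => by
    simp only [hq]
    rw [abs_div, abs_of_pos (hpos t), div_le_div_iff₀ (hpos t) hδ]
    nlinarith [sq_abs (g t), sq_nonneg (|g t| - δ), abs_nonneg (g t), sq_nonneg (|g t|)]
  have bq' : ∀ t ∈ Set.Icc 0 L, |q' t| ≤ M * (1 / (g t ^ 2 + δ ^ 2)) := fun t ht => by
    simp only [hq']
    rw [abs_div, abs_mul, abs_of_pos (pow_pos (hpos t) 2)]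
    have h1 : |δ ^ 2 - g t ^ 2| ≤ g t ^ 2 + δ ^ 2 :=
      abs_le.2 ⟨by nlinarith [sq_nonneg δ], by nlinarith [sq_nonneg (g t)]⟩
    calc |g' t| * |δ ^ 2 - g t ^ 2| / (g t ^ 2 + δ ^ 2) ^ 2
        ≤ M * (g t ^ 2 + δ ^ 2) / (g t ^ 2 + δ ^ 2) ^ 2 := by
          gcongr
          exact hM t ht
      _ = _ := by
          have := (hpos t).ne'
          field_simp
  have dE : ∀ t, HasDerivAt E (E t * (Complex.I * ((g t / δ ^ 2 : ℝ) : ℂ))) t := fun t =>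
    (((hΦ t).ofReal_comp).const_mul Complex.I).cexp
  have dF : ∀ t, HasDerivAt (fun t => ((A t * q t : ℝ) : ℂ) * E t)
      (((A' t * q t + A t * q' t : ℝ) : ℂ) * E t +
        ((A t * q t : ℝ) : ℂ) * (E t * (Complex.I * ((g t / δ ^ 2 : ℝ) : ℂ)))) t := fun t =>
    ((hA t).mul (dq t)).ofReal_comp.mul (dE t)
  have cF : Continuous fun t => (((A' t * q t + A t * q' t : ℝ) : ℂ) * E t +
        ((A t * q t : ℝ) : ℂ) * (E t * (Complex.I * ((g t / δ ^ 2 : ℝ) : ℂ)))) := by fun_prop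
  have cR : Continuous fun t => ((A t * (δ ^ 2 / (g t ^ 2 + δ ^ 2)) : ℝ) : ℂ) * E t +
      Complex.I * (δ : ℂ) ^ 2 * (((A' t * q t + A t * q' t : ℝ) : ℂ) * E t) := by
    have : Continuous fun t => δ ^ 2 / (g t ^ 2 + δ ^ 2) :=
      Continuous.div (by fun_prop) (by fun_prop) fun t => (hpos t).ne'
    fun_prop
  have key : ∀ t, (A t : ℂ) * E t = -(Complex.I * (δ : ℂ) ^ 2) *
      (((A' t * q t + A t * q' t : ℝ) : ℂ) * E t +
        ((A t * q t : ℝ) : ℂ) * (E t * (Complex.I * ((g t / δ ^ 2 : ℝ) : ℂ)))) +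
      (((A t * (δ ^ 2 / (g t ^ 2 + δ ^ 2)) : ℝ) : ℂ) * E t +
      Complex.I * (δ : ℂ) ^ 2 * (((A' t * q t + A t * q' t : ℝ) : ℂ) * E t)) := fun t => by
    have h1 : A t = A t * q t * g t + A t * (δ ^ 2 / (g t ^ 2 + δ ^ 2)) := by
      simp only [hq]
      have := (hpos t).ne'
      field_simp
    have h2 : (δ : ℂ) ^ 2 * ((g t / δ ^ 2 : ℝ) : ℂ) = g t := by
      have : (δ : ℂ) ≠ 0 := by exact_mod_cast hδ.ne'
      push_cast
      field_simp
    have h3 := congrArg (fun x : ℝ => (x : ℂ)) h1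
    simp only [Complex.ofReal_add, Complex.ofReal_mul] at h3
    simp only [Complex.ofReal_add, Complex.ofReal_mul] at h2 ⊢
    linear_combination E t * h3 + (Complex.I ^ 2 * A t * q t * E t) * h2 +
      (A t * q t * E t * g t) * Complex.I_sq
  have bR : ∀ t ∈ Set.Ioc 0 L, ‖((A t * (δ ^ 2 / (g t ^ 2 + δ ^ 2)) : ℝ) : ℂ) * E t +
      Complex.I * (δ : ℂ) ^ 2 * (((A' t * q t + A t * q' t : ℝ) : ℂ) * E t)‖ ≤
      δ * |A' t| + δ ^ 2 * (M + 1) * (1 / (g t ^ 2 + δ ^ 2)) := fun t ht => by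
    refine (norm_add_le _ _).trans ?_
    simp only [norm_mul, norm_pow, nE, Complex.norm_I, Complex.norm_real, Real.norm_eq_abs, mul_one,
      one_mul, abs_of_pos hδ]
    have h1 : |A t| * |δ ^ 2 / (g t ^ 2 + δ ^ 2)| ≤ 1 * (δ ^ 2 / (g t ^ 2 + δ ^ 2)) := by
      rw [abs_of_pos (div_pos (pow_pos hδ 2) (hpos t))]
      have := div_pos (pow_pos hδ 2) (hpos t)
      gcongr
      exact hA1 t
    have h2 : |A' t * q t + A t * q' t| ≤ |A' t| * (1 / δ) + 1 * (M * (1 / (g t ^ 2 + δ ^ 2))) := by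
      refine (abs_add_le _ _).trans ?_
      rw [abs_mul, abs_mul]
      gcongr
      · exact bq t
      · exact hA1 t
      · exact bq' t ⟨ht.1.le, ht.2⟩
    calc _ ≤ 1 * (δ ^ 2 / (g t ^ 2 + δ ^ 2)) +
          δ ^ 2 * (|A' t| * (1 / δ) + 1 * (M * (1 / (g t ^ 2 + δ ^ 2)))) := by gcongr
      _ = _ := by
          have := (hpos t).ne'
          field_simp
          ring
  have cinv : Continuous fun t => 1 / (g t ^ 2 + δ ^ 2) :=
    Continuous.div (by fun_prop) (by fun_prop) fun t => (hpos t).ne'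
  have bd : ∀ t, ‖((A t * q t : ℝ) : ℂ) * E t‖ ≤ 1 / δ := fun t => by
    rw [norm_mul, nE, mul_one, Complex.norm_real, Real.norm_eq_abs, abs_mul]
    calc _ ≤ 1 * (1 / δ) := mul_le_mul (hA1 t) (bq t) (abs_nonneg _) zero_le_one
      _ = _ := one_mul _
  have hR : ‖∫ t in (0 : ℝ)..L, (((A t * (δ ^ 2 / (g t ^ 2 + δ ^ 2)) : ℝ) : ℂ) * E t +
      Complex.I * (δ : ℂ) ^ 2 * (((A' t * q t + A t * q' t : ℝ) : ℂ) * E t))‖ ≤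
      δ * D + δ ^ 2 * (M + 1) * (C / δ) := by
    refine (intervalIntegral.norm_integral_le_of_norm_le hL
      (Filter.Eventually.of_forall bR) (Continuous.intervalIntegrable (by fun_prop) _ _)).trans ?_
    rw [intervalIntegral.integral_add (Continuous.intervalIntegrable (by fun_prop) _ _)
      (Continuous.intervalIntegrable (by fun_prop) _ _), intervalIntegral.integral_const_mul,
      intervalIntegral.integral_const_mul]
    gcongr
  change ‖∫ t in (0 : ℝ)..L, (A t : ℂ) * E t‖ ≤ _
  rw [intervalIntegral.integral_congr fun t _ => key t, intervalIntegral.integral_add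
    ((cF.const_mul _).intervalIntegrable _ _) (cR.intervalIntegrable _ _),
    intervalIntegral.integral_const_mul, intervalIntegral.integral_eq_sub_of_hasDerivAt
      (fun t _ => dF t) (cF.intervalIntegrable _ _)]
  refine (norm_add_le _ _).trans ?_
  have h1 : ‖-(Complex.I * (δ : ℂ) ^ 2) *
      (((A L * q L : ℝ) : ℂ) * E L - ((A 0 * q 0 : ℝ) : ℂ) * E 0)‖ ≤
      δ ^ 2 * (1 / δ + 1 / δ) := by
    rw [norm_mul, norm_neg, norm_mul, norm_pow, Complex.norm_I, Complex.norm_real,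
      Real.norm_of_nonneg hδ.le, one_mul]
    gcongr
    exact (norm_sub_le _ _).trans (add_le_add (bd L) (bd 0))
  calc _ ≤ δ ^ 2 * (1 / δ + 1 / δ) + (δ * D + δ ^ 2 * (M + 1) * (C / δ)) := add_le_add h1 hR
    _ = _ := by
      field_simp
      ring

/-- The circumradius formula for a triangle inscribed in a circle centred at the origin. -/
theorem four_mul_sq_mul_det_sq {R p₁ p₂ u₁ u₂ v₁ v₂ : ℝ} (hp : p₁ ^ 2 + p₂ ^ 2 = R ^ 2)
    (hu : (p₁ + u₁) ^ 2 + (p₂ + u₂) ^ 2 = R ^ 2) (hv : (p₁ + v₁) ^ 2 + (p₂ + v₂) ^ 2 = R ^ 2) :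
    4 * R ^ 2 * (u₁ * v₂ - u₂ * v₁) ^ 2 =
      (u₁ ^ 2 + u₂ ^ 2) * (v₁ ^ 2 + v₂ ^ 2) * ((u₁ - v₁) ^ 2 + (u₂ - v₂) ^ 2) := by
  have h1 : u₁ ^ 2 + u₂ ^ 2 = -2 * (p₁ * u₁ + p₂ * u₂) := by linarith
  have h2 : v₁ ^ 2 + v₂ ^ 2 = -2 * (p₁ * v₁ + p₂ * v₂) := by linarith
  have h3 : (u₁ ^ 2 + u₂ ^ 2) * (v₁ ^ 2 + v₂ ^ 2) * ((u₁ - v₁) ^ 2 + (u₂ - v₂) ^ 2) =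
      ((u₁ ^ 2 + u₂ ^ 2) * v₁ - (v₁ ^ 2 + v₂ ^ 2) * u₁) ^ 2 +
      ((u₁ ^ 2 + u₂ ^ 2) * v₂ - (v₁ ^ 2 + v₂ ^ 2) * u₂) ^ 2 := by ring
  rw [h3, h1, h2, ← hp]
  ring

theorem mem_Elat {lam : ℝ} {μ : ℤ × ℤ} (h : μ ∈ Elat lam) :
    (μ.1 : ℝ) ^ 2 + (μ.2 : ℝ) ^ 2 = lam ^ 2 := by
  simp only [Elat, Finset.mem_filter] at h
  exact h.2

/-- Jarník: three lattice points on a circle of radius `R` cannot be too close together. -/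
theorem eq_of_close {R r : ℝ} (hR : 0 < R) (hr : r ^ 3 ≤ R ^ 2) {μ ν ξ : ℤ × ℤ}
    (hμ : (μ.1 : ℝ) ^ 2 + (μ.2 : ℝ) ^ 2 = R ^ 2) (hν : (ν.1 : ℝ) ^ 2 + (ν.2 : ℝ) ^ 2 = R ^ 2)
    (hξ : (ξ.1 : ℝ) ^ 2 + (ξ.2 : ℝ) ^ 2 = R ^ 2)
    (h1 : ((μ.1 : ℝ) - ν.1) ^ 2 + ((μ.2 : ℝ) - ν.2) ^ 2 < r)
    (h2 : ((μ.1 : ℝ) - ξ.1) ^ 2 + ((μ.2 : ℝ) - ξ.2) ^ 2 < r)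
    (hμν : ν ≠ μ) (hμξ : ξ ≠ μ) : ν = ξ := by
  have key := four_mul_sq_mul_det_sq (R := R) (p₁ := μ.1) (p₂ := μ.2) (u₁ := ν.1 - μ.1)
    (u₂ := ν.2 - μ.2) (v₁ := ξ.1 - μ.1) (v₂ := ξ.2 - μ.2) hμ (by simpa using hν) (by simpa using hξ)
  have pos : ∀ α β : ℤ × ℤ, α ≠ β → 0 < ((α.1 : ℝ) - β.1) ^ 2 + ((α.2 : ℝ) - β.2) ^ 2 := by
    intro α β h
    rcases eq_or_ne α.1 β.1 with h' | h'
    · have h'' : α.2 ≠ β.2 := fun h2 => h (Prod.ext h' h2)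
      have : (α.2 : ℝ) - β.2 ≠ 0 := sub_ne_zero.2 (by exact_mod_cast h'')
      positivity
    · have : (α.1 : ℝ) - β.1 ≠ 0 := sub_ne_zero.2 (by exact_mod_cast h')
      positivity
  by_contra hne
  have pu := pos ν μ hμν
  have pv := pos ξ μ hμξ
  have pw := pos ν ξ hne
  set d : ℤ := (ν.1 - μ.1) * (ξ.2 - μ.2) - (ν.2 - μ.2) * (ξ.1 - μ.1) with hd
  have hdr : ((ν.1 : ℝ) - μ.1) * (ξ.2 - μ.2) - (ν.2 - μ.2) * (ξ.1 - μ.1) = (d : ℝ) := by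
    rw [hd]; push_cast; ring
  rw [hdr] at key
  have e3 : ((ν.1 : ℝ) - μ.1 - (ξ.1 - μ.1)) ^ 2 + ((ν.2 : ℝ) - μ.2 - (ξ.2 - μ.2)) ^ 2 =
      ((ν.1 : ℝ) - ξ.1) ^ 2 + ((ν.2 : ℝ) - ξ.2) ^ 2 := by ring
  rw [e3] at key
  have d0 : d ≠ 0 := by
    rintro h
    have := mul_pos (mul_pos pu pv) pw
    rw [← key, h] at this
    simp at this
  have d1 : (1 : ℝ) ≤ (d : ℝ) ^ 2 := by
    exact_mod_cast (by positivity : 0 < d ^ 2)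
  set a := ((ν.1 : ℝ) - μ.1) ^ 2 + ((ν.2 : ℝ) - μ.2) ^ 2 with ha
  set b := ((ξ.1 : ℝ) - μ.1) ^ 2 + ((ξ.2 : ℝ) - μ.2) ^ 2 with hb
  have ar : a < r := by rw [ha]; linarith
  have br : b < r := by rw [hb]; linarith
  have cr : ((ν.1 : ℝ) - ξ.1) ^ 2 + ((ν.2 : ℝ) - ξ.2) ^ 2 ≤ 2 * a + 2 * b := by
    rw [ha, hb]
    linarith [sq_nonneg ((ν.1 : ℝ) - μ.1 + (ξ.1 - μ.1)), sq_nonneg ((ν.2 : ℝ) - μ.2 + (ξ.2 - μ.2))]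
  have : a * b * (((ν.1 : ℝ) - ξ.1) ^ 2 + ((ν.2 : ℝ) - ξ.2) ^ 2) < r * r * (4 * r) := by
    have h5 : a * b < r * r := mul_lt_mul'' ar br pu.le pv.le
    exact mul_lt_mul'' h5 (by linarith) (mul_pos pu pv).le pw.le
  have h6 := mul_le_mul_of_nonneg_left d1 (by positivity : 0 ≤ 4 * R ^ 2)
  have h7 : r * r * (4 * r) = 4 * r ^ 3 := by ring
  linarith

/-- Each lattice point on the circle of radius `lam` has at most one close neighbour. -/
theorem card_filter_close_le {lam r : ℝ} (hlam : 0 < lam) (hr : r ^ 3 ≤ lam ^ 2) {μ : ℤ × ℤ}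
    (hμ : μ ∈ Elat lam) :
    ((Elat lam).filter fun ν =>
      ((μ.1 : ℝ) - ν.1) ^ 2 + ((μ.2 : ℝ) - ν.2) ^ 2 < r).card ≤ 2 := by
  refine (Finset.card_le_card_sdiff_add_card (t := {μ})).trans ?_
  rw [Finset.card_singleton]
  refine Nat.succ_le_succ (Finset.card_le_one.2 fun ν hν ξ hξ => ?_)
  simp only [Finset.mem_sdiff, Finset.mem_filter, Finset.mem_singleton] at hν hξ
  exact eq_of_close hlam hr (mem_Elat hμ) (mem_Elat hν.1.1) (mem_Elat hξ.1.1) hν.1.2 hξ.1.2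
    hν.2 hξ.2

/-- A Schur-type bound for a sparse symmetric relation plus a uniform remainder. -/
theorem sum_sum_mul_ite_add_le {ι : Type*} (S : Finset ι) (near : ι → ι → Prop)
    [DecidableRel near] (symm : ∀ i j, near i j → near j i)
    (hcard : ∀ i ∈ S, (S.filter (near i)).card ≤ 2) (b : ι → ℝ) {P Q : ℝ} (hP : 0 ≤ P)
    (hQ : 0 ≤ Q) (hb : ∑ i ∈ S, b i ^ 2 = 1) :
    ∑ i ∈ S, ∑ j ∈ S, b i * b j * ((if near i j then P else 0) + Q) ≤ 2 * P + S.card * Q := by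
  have h1 : ∑ i ∈ S, ∑ j ∈ S, b i * b j * Q ≤ S.card * Q := by
    have := sq_sum_le_card_mul_sum_sq (s := S) (f := b)
    rw [hb, mul_one, sq, Finset.sum_mul_sum] at this
    simp only [← Finset.sum_mul]
    exact mul_le_mul_of_nonneg_right this hQ
  have h3 : ∑ i ∈ S, ∑ j ∈ S, (if near i j then b i ^ 2 * (P / 2) else 0) ≤ P := by
    calc _ ≤ ∑ i ∈ S, b i ^ 2 * P := by
          refine Finset.sum_le_sum fun i hi => ?_
          rw [← Finset.sum_filter, Finset.sum_const, nsmul_eq_mul]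
          have h : (((S.filter (near i)).card : ℕ) : ℝ) ≤ 2 := by exact_mod_cast hcard i hi
          calc _ ≤ 2 * (b i ^ 2 * (P / 2)) := by gcongr
            _ = _ := by ring
      _ = P := by rw [← Finset.sum_mul, hb, one_mul]
  have h4 : ∑ i ∈ S, ∑ j ∈ S, (if near i j then b j ^ 2 * (P / 2) else 0) ≤ P := by
    rw [Finset.sum_comm]
    refine le_trans (le_of_eq ?_) h3
    refine Finset.sum_congr rfl fun i _ => Finset.sum_congr rfl fun j _ => ?_
    simp only [show near j i ↔ near i j from ⟨symm _ _, symm _ _⟩]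
  have h2 : ∑ i ∈ S, ∑ j ∈ S, b i * b j * (if near i j then P else 0) ≤ 2 * P := by
    calc _ ≤ ∑ i ∈ S, ∑ j ∈ S, ((if near i j then b i ^ 2 * (P / 2) else 0) +
          (if near i j then b j ^ 2 * (P / 2) else 0)) := by
          refine Finset.sum_le_sum fun i _ => Finset.sum_le_sum fun j _ => ?_
          split_ifs
          · nlinarith [mul_nonneg hP (sq_nonneg (b i - b j))]
          · simp
      _ ≤ 2 * P := by
          simp only [Finset.sum_add_distrib]
          linarith
  simp only [mul_add, Finset.sum_add_distrib]
  linarith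

theorem integral_norm_sum_sq_le {ι : Type*} (S : Finset ι) (F : ι → ℝ → ℂ) (a b : ℝ)
    (hF : ∀ i ∈ S, Continuous (F i)) :
    ∫ t in a..b, ‖∑ i ∈ S, F i t‖ ^ 2 ≤
      ∑ i ∈ S, ∑ j ∈ S, ‖∫ t in a..b, F i t * (starRingEnd ℂ) (F j t)‖ := by
  have h : ((∫ t in a..b, ‖∑ i ∈ S, F i t‖ ^ 2 : ℝ) : ℂ) =
      ∑ i ∈ S, ∑ j ∈ S, ∫ t in a..b, F i t * (starRingEnd ℂ) (F j t) := by
    have hc : ∀ i ∈ S, ∀ j ∈ S, Continuous fun t => F i t * (starRingEnd ℂ) (F j t) :=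
      fun i hi j hj => (hF i hi).mul (Complex.continuous_conj.comp (hF j hj))
    rw [← intervalIntegral.integral_ofReal]
    calc _ = ∫ t in a..b, ∑ i ∈ S, ∑ j ∈ S, F i t * (starRingEnd ℂ) (F j t) := by
          refine intervalIntegral.integral_congr fun t _ => ?_
          rw [← Finset.sum_mul_sum, ← map_sum, Complex.mul_conj, Complex.normSq_eq_norm_sq]
      _ = _ := by
          rw [intervalIntegral.integral_finsetSum fun i hi => (continuous_finsetSum _
            fun j hj => hc i hi j hj).intervalIntegrable _ _]
          refine Finset.sum_congr rfl fun i hi => ?_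
          rw [intervalIntegral.integral_finsetSum fun j hj =>
            (hc i hi j hj).intervalIntegrable _ _]
  calc _ ≤ ‖((∫ t in a..b, ‖∑ i ∈ S, F i t‖ ^ 2 : ℝ) : ℂ)‖ := by
        rw [Complex.norm_real]; exact le_abs_self _
    _ ≤ _ := by
        rw [h]
        exact (norm_sum_le _ _).trans (Finset.sum_le_sum fun i _ => norm_sum_le _ _)

/-- The projections of the unit tangent `(p, q)` of a curve with nonvanishing curvature onto unit
vectors have bounded derivative and spend little time near `0`, uniformly in the vector. -/
theorem exists_bound_tangent_projection {L Kmin : ℝ} {p p' p'' q q' q'' : ℝ → ℝ} (hL : 0 < L)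
    (hKmin : 0 < Kmin)
    (hp : ∀ t, HasDerivAt p (p' t) t) (hp' : ∀ t, HasDerivAt p' (p'' t) t) (cp : Continuous p'')
    (hq : ∀ t, HasDerivAt q (q' t) t) (hq' : ∀ t, HasDerivAt q' (q'' t) t) (cq : Continuous q'')
    (hunit : ∀ t ∈ Set.Icc 0 L, p t ^ 2 + q t ^ 2 = 1)
    (hcurv : ∀ t ∈ Set.Icc 0 L, Kmin ^ 2 ≤ p' t ^ 2 + q' t ^ 2) :
    ∃ M C : ℝ, 0 ≤ M ∧ 0 ≤ C ∧ ∀ v₁ v₂ : ℝ, v₁ ^ 2 + v₂ ^ 2 = 1 →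
      (∀ t ∈ Set.Icc 0 L, |v₁ * p' t + v₂ * q' t| ≤ M) ∧
      ∀ δ : ℝ, 0 < δ → δ ≤ 1 →
        ∫ t in (0 : ℝ)..L, 1 / ((v₁ * p t + v₂ * q t) ^ 2 + δ ^ 2) ≤ C / δ := by
  have cp' : Continuous p' := continuous_iff_continuousAt.2 fun t => (hp' t).continuousAt
  have cq' : Continuous q' := continuous_iff_continuousAt.2 fun t => (hq' t).continuousAt
  have hcont : Continuous fun t => |p' t| + |q' t| + |p'' t| + |q'' t| := by fun_prop
  obtain ⟨M, hM⟩ := (isCompact_Icc (a := (0 : ℝ)) (b := L)).exists_bound_of_continuousOn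
    hcont.continuousOn
  have hM0 : 0 ≤ M := (norm_nonneg _).trans (hM 0 ⟨le_rfl, hL.le⟩)
  have hM' : ∀ t ∈ Set.Icc 0 L, |p' t| + |q' t| + |p'' t| + |q'' t| ≤ M := fun t ht =>
    (le_abs_self _).trans (hM t ht)
  have horth : ∀ t ∈ Set.Ioo 0 L, p t * p' t + q t * q' t = 0 := fun t ht => by
    have h1 : HasDerivAt (fun t => p t ^ 2 + q t ^ 2) (2 * (p t * p' t + q t * q' t)) t := by
      refine (((hp t).pow 2).add ((hq t).pow 2)).congr_deriv ?_
      push_cast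
      ring
    have h2 : HasDerivAt (fun t => p t ^ 2 + q t ^ 2) 0 t := by
      refine (hasDerivAt_const t (1 : ℝ)).congr_of_eventuallyEq ?_
      filter_upwards [Ioo_mem_nhds ht.1 ht.2] with s hs
      exact hunit s ⟨hs.1.le, hs.2.le⟩
    linarith [h1.unique h2]
  have hbd : ∀ v₁ v₂ x y : ℝ, v₁ ^ 2 + v₂ ^ 2 = 1 → |x| + |y| ≤ M → |v₁ * x + v₂ * y| ≤ M := by
    intro v₁ v₂ x y hv hxy
    have h1 : |v₁| ≤ 1 := by rw [← sq_le_one_iff_abs_le_one]; nlinarith [sq_nonneg v₂]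
    have h2 : |v₂| ≤ 1 := by rw [← sq_le_one_iff_abs_le_one]; nlinarith [sq_nonneg v₁]
    refine (abs_add_le _ _).trans (le_trans ?_ hxy)
    rw [abs_mul, abs_mul]
    nlinarith [abs_nonneg x, abs_nonneg y]
  refine ⟨M, L + 1 / Kmin ^ 2 * (M * π + M * (π / 2) * L), hM0, by positivity,
    fun v₁ v₂ hv => ⟨fun t ht => hbd _ _ _ _ hv ?_, fun δ hδ hδ1 => ?_⟩⟩
  · linarith [hM' t ht, abs_nonneg (p'' t), abs_nonneg (q'' t)]
  · refine integral_inv_sq_add_sq_le (g' := fun t => v₁ * p' t + v₂ * q' t)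
      (g'' := fun t => v₁ * p'' t + v₂ * q'' t) hL.le
      (fun t => ((hp t).const_mul _).add ((hq t).const_mul _))
      (fun t => ((hp' t).const_mul _).add ((hq' t).const_mul _)) (by fun_prop)
      (fun t ht => hbd _ _ _ _ hv ?_) (fun t ht => hbd _ _ _ _ hv ?_) (by positivity)
      (fun t ht => ?_) hδ hδ1
    · linarith [hM' t ht, abs_nonneg (p'' t), abs_nonneg (q'' t)]
    · linarith [hM' t ht, abs_nonneg (p' t), abs_nonneg (q' t)]
    · have ht' : t ∈ Set.Icc 0 L := ⟨ht.1.le, ht.2.le⟩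
      have h1 := hunit t ht'
      have h2 := horth t ht
      have h3 := hcurv t ht'
      set k := p t * q' t - q t * p' t with hk
      have e1 : p' t = -k * q t := by rw [hk]; linear_combination (-p' t) * h1 + p t * h2
      have e2 : q' t = k * p t := by rw [hk]; linear_combination (-q' t) * h1 + q t * h2
      have hk2 : Kmin ^ 2 ≤ k ^ 2 := by
        rw [e1, e2] at h3
        calc _ ≤ _ := h3
          _ = k ^ 2 * (p t ^ 2 + q t ^ 2) := by ring
          _ = _ := by rw [h1, mul_one]
      have hfac : 1 ≤ 1 / Kmin ^ 2 * k ^ 2 := by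
        rw [one_div, inv_mul_eq_div, one_le_div (by positivity)]
        exact hk2
      have e3 : (v₁ * p t + v₂ * q t) ^ 2 + (v₂ * p t - v₁ * q t) ^ 2 = 1 := by
        calc _ = (v₁ ^ 2 + v₂ ^ 2) * (p t ^ 2 + q t ^ 2) := by ring
          _ = 1 := by rw [hv, h1, mul_one]
      calc (1 : ℝ) = (v₁ * p t + v₂ * q t) ^ 2 + 1 * (v₂ * p t - v₁ * q t) ^ 2 := by linarith
        _ ≤ (v₁ * p t + v₂ * q t) ^ 2 + 1 / Kmin ^ 2 * k ^ 2 * (v₂ * p t - v₁ * q t) ^ 2 := by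
            gcongr
        _ = _ := by
            rw [e1, e2]
            ring

theorem exists_cutoff_bound {θ : ℝ → ℝ} (hθ : ContDiff ℝ (⊤ : ℕ∞) θ)
    (hθrange : ∀ x, θ x ∈ Set.Icc (0 : ℝ) 1) (hθzero : ∀ x : ℝ, 2 < |x| → θ x = 0) :
    ∃ S : ℝ, 0 ≤ S ∧ ∀ x, θ x ≤ S / (x ^ 2 + 1) ∧ |deriv θ x| ≤ S / (x ^ 2 + 1) := by
  have cθ' : Continuous (deriv θ) := hθ.continuous_deriv (by simp)
  obtain ⟨S, hS⟩ := (isCompact_Icc (a := (-2 : ℝ)) (b := 2)).exists_bound_of_continuousOn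
    cθ'.continuousOn
  have hS0 : 0 ≤ S := (norm_nonneg _).trans (hS 0 (by norm_num))
  refine ⟨5 * (S + 1), by positivity, fun x => ?_⟩
  have hx1 : 0 < x ^ 2 + 1 := by positivity
  rcases le_or_gt |x| 2 with hx | hx
  · have hx2 : x ^ 2 + 1 ≤ 5 := by nlinarith [sq_abs x, abs_nonneg x]
    have h1 := hS x (abs_le.1 hx)
    rw [Real.norm_eq_abs] at h1
    constructor
    · rw [le_div_iff₀ hx1]
      nlinarith [(hθrange x).1, (hθrange x).2]
    · rw [le_div_iff₀ hx1]
      nlinarith [abs_nonneg (deriv θ x)]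
  · have h : θ =ᶠ[nhds x] fun _ => 0 := by
      filter_upwards [(isOpen_lt continuous_const continuous_abs).mem_nhds hx] with y hy
      exact hθzero y hy
    rw [hθzero x hx, h.deriv_eq]
    simp only [deriv_const, abs_zero, and_self]
    positivity

/-- `L¹` bounds for a rescaled cutoff composed with `g` and for its derivative. -/
theorem integral_cutoff_le {L M C S σ : ℝ} {θ θ' g g' : ℝ → ℝ} (hL : 0 ≤ L) (hσ : 0 < σ)
    (hM0 : 0 ≤ M) (hS0 : 0 ≤ S) (cθ : Continuous θ) (cθ' : Continuous θ') (cg : Continuous g)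
    (cg' : Continuous g') (hθ : ∀ x, θ x ≤ S / (x ^ 2 + 1)) (hθ' : ∀ x, |θ' x| ≤ S / (x ^ 2 + 1))
    (hM : ∀ t ∈ Set.Icc 0 L, |g' t| ≤ M)
    (hC : ∫ t in (0 : ℝ)..L, 1 / (g t ^ 2 + σ ^ 2) ≤ C / σ) :
    ∫ t in (0 : ℝ)..L, θ (g t / σ) ≤ S * C * σ ∧
      ∫ t in (0 : ℝ)..L, |θ' (g t / σ) * (g' t / σ)| ≤ S * M * C := by
  have hpos : ∀ t, 0 < g t ^ 2 + σ ^ 2 := fun t => by positivity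
  have cinv : Continuous fun t => 1 / (g t ^ 2 + σ ^ 2) :=
    Continuous.div (by fun_prop) (by fun_prop) fun t => (hpos t).ne'
  have hscale : ∀ t, S / ((g t / σ) ^ 2 + 1) = S * σ ^ 2 * (1 / (g t ^ 2 + σ ^ 2)) := fun t => by
    have := (hpos t).ne'
    field_simp
  constructor
  · calc _ ≤ ∫ t in (0 : ℝ)..L, S * σ ^ 2 * (1 / (g t ^ 2 + σ ^ 2)) := by
          refine intervalIntegral.integral_mono_on hL
            (Continuous.intervalIntegrable (by fun_prop) _ _)
            (Continuous.intervalIntegrable (by fun_prop) _ _) fun t _ => ?_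
          exact (hθ _).trans (hscale t).le
      _ ≤ S * σ ^ 2 * (C / σ) := by
          rw [intervalIntegral.integral_const_mul]
          gcongr
      _ = _ := by field_simp
  · calc _ ≤ ∫ t in (0 : ℝ)..L, S * M * σ * (1 / (g t ^ 2 + σ ^ 2)) := by
          refine intervalIntegral.integral_mono_on hL
            (Continuous.intervalIntegrable (by fun_prop) _ _)
            (Continuous.intervalIntegrable (by fun_prop) _ _) fun t ht => ?_
          rw [abs_mul, abs_div, abs_of_pos hσ]
          calc _ ≤ S * σ ^ 2 * (1 / (g t ^ 2 + σ ^ 2)) * (M / σ) := by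
                have h1 := (hθ' (g t / σ)).trans (hscale t).le
                have h2 := hM t ht
                have h3 := (abs_nonneg (θ' (g t / σ))).trans h1
                gcongr
            _ = _ := by field_simp
      _ ≤ S * M * σ * (C / σ) := by
          rw [intervalIntegral.integral_const_mul]
          gcongr
      _ = _ := by field_simp

theorem hasDerivAt_fst_snd {f : ℝ → ℝ × ℝ} (hf : ContDiff ℝ (⊤ : ℕ∞) f) (t : ℝ) :
    HasDerivAt (fun t => (f t).1) (deriv f t).1 t ∧
      HasDerivAt (fun t => (f t).2) (deriv f t).2 t := by
  have h := ((hf.differentiable (by simp)) t).hasDerivAt.hasFDerivAt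
  exact ⟨by simpa using h.fst.hasDerivAt, by simpa using h.snd.hasDerivAt⟩

/-- The bound for a single pair `μ`, `ν` of lattice points on the circle of radius `lam`. -/
theorem norm_integral_pair_le {L M C S lam σ : ℝ} {x y p p' q q' θ θ' : ℝ → ℝ} (hL : 0 ≤ L)
    (hM0 : 0 ≤ M) (hC0 : 0 ≤ C) (hS0 : 0 ≤ S)
    (hx : ∀ t, HasDerivAt x (p t) t) (hy : ∀ t, HasDerivAt y (q t) t)
    (hp : ∀ t, HasDerivAt p (p' t) t) (hq : ∀ t, HasDerivAt q (q' t) t)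
    (cp' : Continuous p') (cq' : Continuous q')
    (hv : ∀ v₁ v₂ : ℝ, v₁ ^ 2 + v₂ ^ 2 = 1 →
      (∀ t ∈ Set.Icc 0 L, |v₁ * p' t + v₂ * q' t| ≤ M) ∧
      ∀ δ : ℝ, 0 < δ → δ ≤ 1 →
        ∫ t in (0 : ℝ)..L, 1 / ((v₁ * p t + v₂ * q t) ^ 2 + δ ^ 2) ≤ C / δ)
    (dθ : ∀ x, HasDerivAt θ (θ' x) x) (cθ' : Continuous θ')
    (hθrange : ∀ x, θ x ∈ Set.Icc (0 : ℝ) 1)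
    (hθ : ∀ x, θ x ≤ S / (x ^ 2 + 1)) (hθ' : ∀ x, |θ' x| ≤ S / (x ^ 2 + 1))
    (hlam : 1 ≤ lam) (hσ : 0 < σ) (hσ1 : σ ≤ 1) {m₁ m₂ n₁ n₂ : ℝ}
    (hm : m₁ ^ 2 + m₂ ^ 2 = lam ^ 2) (hn : n₁ ^ 2 + n₂ ^ 2 = lam ^ 2) :
    ‖∫ t in (0 : ℝ)..L, ((θ ((m₁ * p t + m₂ * q t) / lam / σ) *
        θ ((n₁ * p t + n₂ * q t) / lam / σ) : ℝ) : ℂ) *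
        Complex.exp (Complex.I * (((m₁ - n₁) * x t + (m₂ - n₂) * y t : ℝ) : ℂ))‖ ≤
      (if (m₁ - n₁) ^ 2 + (m₂ - n₂) ^ 2 < lam ^ ((2 : ℝ) / 3) then S * C * σ else 0) +
        (2 + 2 * (S * M * C) + (M + 1) * C) * lam ^ (-((1 : ℝ) / 6)) := by
  have hlam0 : 0 < lam := by linarith
  have cx : Continuous x := continuous_iff_continuousAt.2 fun t => (hx t).continuousAt
  have cy : Continuous y := continuous_iff_continuousAt.2 fun t => (hy t).continuousAt
  have cp : Continuous p := continuous_iff_continuousAt.2 fun t => (hp t).continuousAt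
  have cq : Continuous q := continuous_iff_continuousAt.2 fun t => (hq t).continuousAt
  have cθ : Continuous θ := continuous_iff_continuousAt.2 fun t => (dθ t).continuousAt
  have hcut : ∀ k₁ k₂ : ℝ, k₁ ^ 2 + k₂ ^ 2 = lam ^ 2 →
      ∫ t in (0 : ℝ)..L, θ ((k₁ * p t + k₂ * q t) / lam / σ) ≤ S * C * σ ∧
      ∫ t in (0 : ℝ)..L, |θ' ((k₁ * p t + k₂ * q t) / lam / σ) *
        ((k₁ * p' t + k₂ * q' t) / lam / σ)| ≤ S * M * C := by
    intro k₁ k₂ hk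
    obtain ⟨h1, h2⟩ := hv (k₁ / lam) (k₂ / lam) (by
      rw [div_pow, div_pow, ← add_div, hk, div_self (by positivity)])
    have e : ∀ a b : ℝ, k₁ / lam * a + k₂ / lam * b = (k₁ * a + k₂ * b) / lam := fun a b => by ring
    simp only [e] at h1 h2
    exact integral_cutoff_le (g := fun t => (k₁ * p t + k₂ * q t) / lam)
      (g' := fun t => (k₁ * p' t + k₂ * q' t) / lam) hL hσ hM0 hS0 cθ cθ' (by fun_prop)
      (by fun_prop) hθ hθ' h1 (h2 σ hσ hσ1)
  have hrem : 0 ≤ (2 + 2 * (S * M * C) + (M + 1) * C) * lam ^ (-((1 : ℝ) / 6)) := by positivity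
  split_ifs with hnear
  · refine le_trans ?_ (le_add_of_nonneg_right hrem)
    refine le_trans ?_ (hcut m₁ m₂ hm).1
    refine intervalIntegral.norm_integral_le_of_norm_le hL (Filter.Eventually.of_forall
      fun t _ => ?_) (Continuous.intervalIntegrable (by fun_prop) _ _)
    rw [norm_mul, mul_comm Complex.I, Complex.norm_exp_ofReal_mul_I, mul_one, Complex.norm_real,
      Real.norm_of_nonneg (mul_nonneg (hθrange _).1 (hθrange _).1)]
    exact mul_le_of_le_one_right (hθrange _).1 (hθrange _).2
  · rw [zero_add]
    push Not at hnear
    set d := (m₁ - n₁) ^ 2 + (m₂ - n₂) ^ 2 with hd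
    have hr1 : 1 ≤ lam ^ ((2 : ℝ) / 3) := Real.one_le_rpow hlam (by norm_num)
    have hd0 : 0 < d := by linarith
    set δ := d ^ (-((1 : ℝ) / 4)) with hδdef
    have hδ : 0 < δ := Real.rpow_pos_of_pos hd0 _
    have hδlam : δ ≤ lam ^ (-((1 : ℝ) / 6)) := by
      calc δ ≤ (lam ^ ((2 : ℝ) / 3)) ^ (-((1 : ℝ) / 4)) :=
            Real.rpow_le_rpow_of_nonpos (by positivity) hnear (by norm_num)
        _ = _ := by rw [← Real.rpow_mul hlam0.le]; norm_num
    have hδ1 : δ ≤ 1 := Real.rpow_le_one_of_one_le_of_nonpos (by linarith) (by norm_num)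
    have hδ4 : d * δ ^ 4 = 1 := by
      rw [hδdef, ← Real.rpow_natCast, ← Real.rpow_mul hd0.le]
      norm_num
      rw [Real.rpow_neg_one, mul_inv_cancel₀ hd0.ne']
    obtain ⟨h1, h2⟩ := hv ((m₁ - n₁) * δ ^ 2) ((m₂ - n₂) * δ ^ 2) (by
      rw [← hδ4, hd]; ring)
    have dT : ∀ k₁ k₂ t, HasDerivAt (fun t => θ ((k₁ * p t + k₂ * q t) / lam / σ))
        (θ' ((k₁ * p t + k₂ * q t) / lam / σ) * ((k₁ * p' t + k₂ * q' t) / lam / σ)) t :=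
      fun k₁ k₂ t => (dθ _).comp t
        (((((hp t).const_mul k₁).add ((hq t).const_mul k₂)).div_const lam).div_const σ)
    refine (norm_integral_mul_exp_le (D := 2 * (S * M * C)) hL hδ
      (fun t => (dT m₁ m₂ t).mul (dT n₁ n₂ t)) (by fun_prop)
      (fun t => ((hp t).const_mul ((m₁ - n₁) * δ ^ 2)).add ((hq t).const_mul ((m₂ - n₂) * δ ^ 2)))
      (by fun_prop) (fun t => ?_) (fun t => ?_) h1 (h2 δ hδ hδ1) ?_).trans ?_
    · refine (((hx t).const_mul (m₁ - n₁)).add ((hy t).const_mul (m₂ - n₂))).congr_deriv ?_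
      simp only [Pi.add_apply]
      field_simp
    · simp only [Pi.mul_apply]
      rw [abs_of_nonneg (mul_nonneg (hθrange _).1 (hθrange _).1)]
      exact mul_le_one₀ (hθrange _).2 (hθrange _).1 (hθrange _).2
    · have hm' := (hcut m₁ m₂ hm).2
      have hn' := (hcut n₁ n₂ hn).2
      calc _ ≤ ∫ t in (0 : ℝ)..L, (|θ' ((m₁ * p t + m₂ * q t) / lam / σ) *
              ((m₁ * p' t + m₂ * q' t) / lam / σ)| + |θ' ((n₁ * p t + n₂ * q t) / lam / σ) *
              ((n₁ * p' t + n₂ * q' t) / lam / σ)|) := by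
            refine intervalIntegral.integral_mono_on hL
              (Continuous.intervalIntegrable (by fun_prop) _ _)
              (Continuous.intervalIntegrable (by fun_prop) _ _) fun t _ => ?_
            refine (abs_add_le _ _).trans (add_le_add ?_ ?_)
            · rw [abs_mul _ (θ _), abs_of_nonneg (hθrange _).1]
              exact mul_le_of_le_one_right (abs_nonneg _) (hθrange _).2
            · rw [abs_mul (θ _), abs_of_nonneg (hθrange _).1]
              exact mul_le_of_le_one_left (abs_nonneg _) (hθrange _).2
        _ ≤ _ := by
            rw [intervalIntegral.integral_add (Continuous.intervalIntegrable (by fun_prop) _ _)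
              (Continuous.intervalIntegrable (by fun_prop) _ _)]
            linarith
    · gcongr

/-- Lemma 5.1: the low-frequency part
`f₀(t) = ∑_{μ ∈ E_lam} a_μ θ(φ_μ'(t)/σ) e^{iλφ_μ(t)}` satisfies
`‖f₀‖₂² ≪ σ + #E_lam/lam^{1/6}`.  Here `φ_μ(t) = ⟨μ/|μ|, γ(t)⟩`, so that
`λφ_μ(t) = ⟨μ, γ(t)⟩` and `φ_μ'(t) = ⟨μ, γ'(t)⟩/λ` for `μ ∈ E_lam`. -/
theorem cutoff_part_L2_bound
    (L Kmin Kmax : ℝ) (γ : ℝ → ℝ × ℝ) (θ : ℝ → ℝ)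
    (hL : 0 < L) (hKmin : 0 < Kmin)
    (hsmooth : ContDiff ℝ (⊤ : ℕ∞) γ)
    (hunit : ∀ t ∈ Set.Icc (0:ℝ) L, e2 (deriv γ t) = 1)
    (hcurv : ∀ t ∈ Set.Icc (0:ℝ) L,
      Kmin ≤ e2 (deriv (deriv γ) t) ∧ e2 (deriv (deriv γ) t) ≤ Kmax)
    (htot : (∫ t in (0:ℝ)..L, e2 (deriv (deriv γ) t)) < π / 2)
    (hθsmooth : ContDiff ℝ (⊤ : ℕ∞) θ)
    (hθrange : ∀ x, θ x ∈ Set.Icc (0:ℝ) 1)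
    (hθeven : ∀ x, θ (-x) = θ x)
    (hθone : ∀ x : ℝ, |x| < 1 → θ x = 1)
    (hθzero : ∀ x : ℝ, 2 < |x| → θ x = 0) :
    ∃ C0 > (0:ℝ), ∀ lam : ℝ, 1 ≤ lam → ∀ σ : ℝ, 0 < σ → σ < 1 →
      ∀ a : ℤ × ℤ → ℂ, (∑ μ ∈ Elat lam, ‖a μ‖ ^ 2) = 1 →
        (∫ t in (0:ℝ)..L, ‖∑ μ ∈ Elat lam,
            a μ * (θ ((((μ.1 : ℝ) * (deriv γ t).1 + (μ.2 : ℝ) * (deriv γ t).2) / lam) / σ) : ℂ) *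
            Complex.exp (Complex.I *
              Complex.ofReal ((μ.1 : ℝ) * (γ t).1 + (μ.2 : ℝ) * (γ t).2))‖ ^ 2)
          ≤ C0 * (σ + ((Elat lam).card : ℝ) / lam ^ ((1:ℝ)/6)) := by
  have c1 : ContDiff ℝ (⊤ : ℕ∞) (deriv γ) := (contDiff_infty_iff_deriv.1 hsmooth).2
  have c2 : ContDiff ℝ (⊤ : ℕ∞) (deriv (deriv γ)) := (contDiff_infty_iff_deriv.1 c1).2
  have c3 : ContDiff ℝ (⊤ : ℕ∞) (deriv (deriv (deriv γ))) := (contDiff_infty_iff_deriv.1 c2).2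
  have d0 := hasDerivAt_fst_snd hsmooth
  have d1 := hasDerivAt_fst_snd c1
  have d2 := hasDerivAt_fst_snd c2
  have k0 := hsmooth.continuous
  have k1 := c1.continuous
  have k2 := c2.continuous
  have k3 := c3.continuous
  have kθ := hθsmooth.continuous
  obtain ⟨M, C, hM, hC, hv⟩ := exists_bound_tangent_projection hL hKmin
    (fun t => (d1 t).1) (fun t => (d2 t).1) (by fun_prop)
    (fun t => (d1 t).2) (fun t => (d2 t).2) (by fun_prop)
    (fun t ht => Real.sqrt_eq_one.1 (hunit t ht))
    (fun t ht => (Real.le_sqrt' hKmin).1 (hcurv t ht).1)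
  obtain ⟨S, hS, hθb⟩ := exists_cutoff_bound hθsmooth hθrange hθzero
  set Q := 2 + 2 * (S * M * C) + (M + 1) * C with hQ
  have hQ0 : 0 < Q := by positivity
  refine ⟨2 * (S * C) + Q, by positivity, fun lam hlam σ hσ hσ1 a ha => ?_⟩
  have hlam0 : 0 < lam := by linarith
  refine (integral_norm_sum_sq_le (Elat lam) _ 0 L fun μ _ => by fun_prop).trans ?_
  have hr : (lam ^ ((2 : ℝ) / 3)) ^ 3 ≤ lam ^ 2 := by
    rw [← Real.rpow_natCast, ← Real.rpow_natCast, ← Real.rpow_mul hlam0.le]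
    norm_num
  have hschur := sum_sum_mul_ite_add_le (Elat lam)
    (fun μ ν => ((μ.1 : ℝ) - ν.1) ^ 2 + ((μ.2 : ℝ) - ν.2) ^ 2 < lam ^ ((2 : ℝ) / 3))
    (fun μ ν h => by rwa [← neg_sq, neg_sub, ← neg_sq ((ν.2 : ℝ) - μ.2), neg_sub])
    (fun μ hμ => card_filter_close_le hlam0 hr hμ) (fun μ => ‖a μ‖)
    (P := S * C * σ) (Q := Q * lam ^ (-((1 : ℝ) / 6))) (by positivity) (by positivity) ha
  refine le_trans (Finset.sum_le_sum fun μ hμ => Finset.sum_le_sum fun ν hν => ?_)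
    (hschur.trans ?_)
  · have hpair := norm_integral_pair_le hL.le hM hC hS (fun t => (d0 t).1) (fun t => (d0 t).2)
      (fun t => (d1 t).1) (fun t => (d1 t).2) (by fun_prop) (by fun_prop) hv
      (fun x => (hθsmooth.differentiable (by simp) x).hasDerivAt)
      (hθsmooth.continuous_deriv (by simp)) hθrange (fun x => (hθb x).1) (fun x => (hθb x).2)
      hlam hσ hσ1.le (mem_Elat hμ) (mem_Elat hν)
    refine le_trans (le_of_eq ?_) (mul_le_mul_of_nonneg_left hpair (by positivity))
    rw [← Complex.norm_conj (a ν), ← norm_mul, ← norm_mul, ← intervalIntegral.integral_const_mul]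
    congr 1
    refine intervalIntegral.integral_congr fun t _ => ?_
    simp only [map_mul, Complex.conj_ofReal, ← Complex.exp_conj, Complex.conj_I]
    rw [show Complex.I * (((μ.1 - ν.1 : ℝ) * (γ t).1 + (μ.2 - ν.2 : ℝ) * (γ t).2 : ℝ) : ℂ) =
      Complex.I * (((μ.1 : ℝ) * (γ t).1 + (μ.2 : ℝ) * (γ t).2 : ℝ) : ℂ) +
      -Complex.I * (((ν.1 : ℝ) * (γ t).1 + (ν.2 : ℝ) * (γ t).2 : ℝ) : ℂ) by push_cast; ring,
      Complex.exp_add]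
    push_cast
    ring
  · rw [Real.rpow_neg hlam0.le, ← div_eq_mul_inv, ← mul_div_assoc]
    have h1 : 0 ≤ Q * σ := by positivity
    have h2 : 0 ≤ 2 * (S * C) * ((Elat lam).card / lam ^ ((1 : ℝ) / 6)) := by positivity
    calc _ = 2 * (S * C) * σ + Q * ((Elat lam).card / lam ^ ((1 : ℝ) / 6)) := by ring
      _ ≤ _ := by linarith
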